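/- Assume ψ is C³, A₀, A₁, A₂ are C², and equations (E1), (E2), (E3) hold at every point of ℝ × ℝ². Then for each j ∈ {1, 2}, at every point of ℝ × ℝ²: ε ∂_t Im(conj(ψ) D_jψ) − ε^{2+2δ} ∂_t Re(conj(D_tψ) D_jψ) + (ε²/2) Σ_{k=1,2} ∂_k( D_jψ · conj(D_kψ) + conj(D_jψ) · D_kψ ) − (ε²/4) ∂_j(Δ|ψ|²) + ∂_j(|ψ|^{2γ}) + (ε^{2+2δ}/4) ∂_t ∂_t ∂_j |ψ|² = 0, where Δ = ∂₁∂₁ + ∂₂∂₂. -/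

import Mathlib

noncomputable section

/-- Spacetime points `(t, x₁, x₂) ∈ ℝ × ℝ²`. -/
abbrev Spt := ℝ × ℝ × ℝ

/-- Partial derivative in the time variable. -/
def ptd {E : Type*} [NormedAddCommGroup E] [NormedSpace ℝ E] (f : Spt → E) (p : Spt) : E :=
  fderiv ℝ f p (1, 0, 0)

/-- Partial derivative in the first spatial variable. -/
def px1 {E : Type*} [NormedAddCommGroup E] [NormedSpace ℝ E] (f : Spt → E) (p : Spt) : E :=
  fderiv ℝ f p (0, 1, 0)

/-- Partial derivative in the second spatial variable. -/
def px2 {E : Type*} [NormedAddCommGroup E] [NormedSpace ℝ E] (f : Spt → E) (p : Spt) : E :=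
  fderiv ℝ f p (0, 0, 1)

/-- Covariant time derivative `D_t ψ = ∂_t ψ − i ε⁻¹ A₀ ψ`. -/
def Dt (ε : ℝ) (A₀ : Spt → ℝ) (ψ : Spt → ℂ) (p : Spt) : ℂ :=
  ptd ψ p - Complex.I * ((ε⁻¹ : ℝ) : ℂ) * ((A₀ p : ℝ) : ℂ) * ψ p

/-- Covariant derivative `D₁ ψ = ∂₁ ψ − i ε^{δ−1} A₁ ψ`. -/
def D1 (ε δ : ℝ) (A₁ : Spt → ℝ) (ψ : Spt → ℂ) (p : Spt) : ℂ :=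
  px1 ψ p - Complex.I * ((ε ^ (δ - 1) : ℝ) : ℂ) * ((A₁ p : ℝ) : ℂ) * ψ p

/-- Covariant derivative `D₂ ψ = ∂₂ ψ − i ε^{δ−1} A₂ ψ`. -/
def D2 (ε δ : ℝ) (A₂ : Spt → ℝ) (ψ : Spt → ℂ) (p : Spt) : ℂ :=
  px2 ψ p - Complex.I * ((ε ^ (δ - 1) : ℝ) : ℂ) * ((A₂ p : ℝ) : ℂ) * ψ p

section CovariantCalculus

open ComplexConjugate

variable {E F : Type*} [NormedAddCommGroup E] [NormedSpace ℝ E]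
  [NormedAddCommGroup F] [NormedSpace ℝ F]

/-- Covariant derivative `∂_v f − i a f` in the direction `v` with potential `a`. -/
def covDeriv (v : E) (a : E → ℝ) (f : E → ℂ) (p : E) : ℂ :=
  fderiv ℝ f p v - Complex.I * (a p : ℂ) * f p

theorem ContDiff.fderiv_apply_const {f : E → F} {m n : WithTop ℕ∞} (hf : ContDiff ℝ n f)
    (hmn : m + 1 ≤ n) (v : E) : ContDiff ℝ m (fun p => fderiv ℝ f p v) :=
  (hf.fderiv_right hmn).clm_apply contDiff_const

theorem ContDiff.covDeriv {f : E → ℂ} {a : E → ℝ} {m n : WithTop ℕ∞} (hf : ContDiff ℝ n f)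
    (ha : ContDiff ℝ m a) (hmn : m + 1 ≤ n) (v : E) : ContDiff ℝ m (covDeriv v a f) := by
  have hf' : ContDiff ℝ m f := hf.of_le (le_trans le_self_add hmn)
  have ha' : ContDiff ℝ m (fun p => (a p : ℂ)) := Complex.ofRealCLM.contDiff.comp ha
  exact (hf.fderiv_apply_const hmn v).sub ((contDiff_const.mul ha').mul hf')

/-- Directional derivatives of a `C²` function commute. -/
theorem ContDiff.fderiv_fderiv_comm {f : E → F} (hf : ContDiff ℝ 2 f) (v w p : E) :
    fderiv ℝ (fun q => fderiv ℝ f q v) p w = fderiv ℝ (fun q => fderiv ℝ f q w) p v := by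
  have hd : DifferentiableAt ℝ (fderiv ℝ f) p :=
    (hf.fderiv_right (m := 1) (by norm_num)).differentiable (by norm_num) p
  have hs : IsSymmSndFDerivAt ℝ f p := hf.contDiffAt.isSymmSndFDerivAt (by simp)
  rw [fderiv_clm_apply hd (differentiableAt_const v), fderiv_clm_apply hd (differentiableAt_const w)]
  simpa using hs.eq w v

theorem fderiv_re_apply {f : E → ℂ} {p : E} (hf : DifferentiableAt ℝ f p) (v : E) :
    fderiv ℝ (fun q => (f q).re) p v = (fderiv ℝ f p v).re := by
  have h := (Complex.reCLM.hasFDerivAt.comp p hf.hasFDerivAt).fderiv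
  exact congrArg (fun L => L v) h

theorem fderiv_im_apply {f : E → ℂ} {p : E} (hf : DifferentiableAt ℝ f p) (v : E) :
    fderiv ℝ (fun q => (f q).im) p v = (fderiv ℝ f p v).im := by
  have h := (Complex.imCLM.hasFDerivAt.comp p hf.hasFDerivAt).fderiv
  exact congrArg (fun L => L v) h

theorem fderiv_ofReal_apply {f : E → ℝ} {p : E} (hf : DifferentiableAt ℝ f p) (v : E) :
    fderiv ℝ (fun q => (f q : ℂ)) p v = (fderiv ℝ f p v : ℂ) := by
  have h := (Complex.ofRealCLM.hasFDerivAt.comp p hf.hasFDerivAt).fderiv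
  exact congrArg (fun L => L v) h

theorem fderiv_conj_apply {f : E → ℂ} {p : E} (hf : DifferentiableAt ℝ f p) (v : E) :
    fderiv ℝ (fun q => conj (f q)) p v = conj (fderiv ℝ f p v) := by
  have h := (Complex.conjCLE.toContinuousLinearMap.hasFDerivAt.comp p hf.hasFDerivAt).fderiv
  exact congrArg (fun L => L v) h

theorem Differentiable.conj_mul {f g : E → ℂ} (hf : Differentiable ℝ f)
    (hg : Differentiable ℝ g) : Differentiable ℝ (fun q => conj (f q) * g q) :=
  (Complex.conjCLE.toContinuousLinearMap.differentiable.comp hf).mul hg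

/-- Leibniz rule for the sesquilinear product: the potentials cancel. -/
theorem fderiv_conj_mul_apply {f g : E → ℂ} (hf : Differentiable ℝ f) (hg : Differentiable ℝ g)
    (v : E) (a : E → ℝ) (p : E) :
    fderiv ℝ (fun q => conj (f q) * g q) p v
      = conj (covDeriv v a f p) * g p + conj (f p) * covDeriv v a g p := by
  have hc : DifferentiableAt ℝ (fun q => conj (f q)) p :=
    (Complex.conjCLE.toContinuousLinearMap.differentiable.comp hf) p
  rw [fderiv_fun_mul hc (hg p)]
  simp only [add_apply, smul_apply, smul_eq_mul,
    fderiv_conj_apply (hf p), covDeriv, map_sub, map_mul, Complex.conj_I, Complex.conj_ofReal]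
  ring

theorem fderiv_re_conj_mul_apply {f g : E → ℂ} (hf : Differentiable ℝ f)
    (hg : Differentiable ℝ g) (v : E) (a : E → ℝ) (p : E) :
    fderiv ℝ (fun q => (conj (f q) * g q).re) p v
      = (conj (covDeriv v a f p) * g p + conj (f p) * covDeriv v a g p).re := by
  rw [fderiv_re_apply (hf.conj_mul hg p), fderiv_conj_mul_apply hf hg v a]

theorem fderiv_im_conj_mul_apply {f g : E → ℂ} (hf : Differentiable ℝ f)
    (hg : Differentiable ℝ g) (v : E) (a : E → ℝ) (p : E) :
    fderiv ℝ (fun q => (conj (f q) * g q).im) p v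
      = (conj (covDeriv v a f p) * g p + conj (f p) * covDeriv v a g p).im := by
  rw [fderiv_im_apply (hf.conj_mul hg p), fderiv_conj_mul_apply hf hg v a]

/-- The commutator of covariant derivatives is multiplication by the curvature. -/
theorem covDeriv_comm {f : E → ℂ} {a b : E → ℝ} (hf : ContDiff ℝ 2 f)
    (ha : Differentiable ℝ a) (hb : Differentiable ℝ b) (v w p : E) :
    covDeriv v a (covDeriv w b f) p = covDeriv w b (covDeriv v a f) p
      - Complex.I * ((fderiv ℝ b p v - fderiv ℝ a p w : ℝ) : ℂ) * f p := by
  have hfd : Differentiable ℝ f := hf.differentiable (by norm_num)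
  have expand : ∀ (c : E → ℝ) (hc : Differentiable ℝ c) (u z : E),
      fderiv ℝ (covDeriv u c f) p z = fderiv ℝ (fun q => fderiv ℝ f q u) p z
        - Complex.I * ((fderiv ℝ c p z : ℂ) * f p + (c p : ℂ) * fderiv ℝ f p z) := by
    intro c hc u z
    have h1 : DifferentiableAt ℝ (fun q => fderiv ℝ f q u) p :=
      (hf.fderiv_apply_const (m := 1) (by norm_num) u).differentiable (by norm_num) p
    have h2 : DifferentiableAt ℝ (fun q => (c q : ℂ)) p :=
      (Complex.ofRealCLM.differentiable.comp hc) p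
    have h3 : DifferentiableAt ℝ (fun q => Complex.I * (c q : ℂ)) p := h2.const_mul _
    have h4 : covDeriv u c f = fun q => fderiv ℝ f q u - Complex.I * (c q : ℂ) * f q := rfl
    rw [h4, fderiv_fun_sub h1 (h3.fun_mul (hfd p)), fderiv_fun_mul h3 (hfd p),
      fderiv_const_mul h2]
    simp only [add_apply, sub_apply,
      smul_apply, smul_eq_mul, fderiv_ofReal_apply (hc p)]
    ring
  rw [covDeriv, covDeriv.eq_1 w b (covDeriv v a f), expand b hb, expand a ha, hf.fderiv_fderiv_comm w v p]
  simp only [covDeriv]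
  push_cast
  ring

theorem normSq_eq_re_conj_mul (z : ℂ) : Complex.normSq z = (conj z * z).re := by
  simp [Complex.normSq_apply]

theorem fderiv_normSq_apply {f : E → ℂ} (hf : Differentiable ℝ f) (v : E) (a : E → ℝ) (p : E) :
    fderiv ℝ (fun q => Complex.normSq (f q)) p v = 2 * (conj (f p) * covDeriv v a f p).re := by
  simp only [normSq_eq_re_conj_mul]
  rw [fderiv_re_conj_mul_apply hf hf v a]
  simp only [Complex.add_re, Complex.mul_re, Complex.conj_re, Complex.conj_im]
  ring

theorem fderiv_fderiv_normSq_apply {f : E → ℂ} {a : E → ℝ} (hf : ContDiff ℝ 2 f)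
    (ha : ContDiff ℝ 1 a) (v p : E) :
    fderiv ℝ (fun q => fderiv ℝ (fun s => Complex.normSq (f s)) q v) p v
      = 2 * (Complex.normSq (covDeriv v a f p)
          + (conj (f p) * covDeriv v a (covDeriv v a f) p).re) := by
  have hfd : Differentiable ℝ f := hf.differentiable (by norm_num)
  have hD : Differentiable ℝ (covDeriv v a f) :=
    (hf.covDeriv ha (by norm_num) v).differentiable (by norm_num)
  have h1 : DifferentiableAt ℝ (fun q => (conj (f q) * covDeriv v a f q).re) p :=
    Complex.reCLM.differentiable.comp (hfd.conj_mul hD) p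
  rw [funext fun q => fderiv_normSq_apply hfd v a q, fderiv_const_mul h1]
  simp only [smul_apply, smul_eq_mul]
  rw [fderiv_re_conj_mul_apply hfd hD v a, normSq_eq_re_conj_mul, Complex.add_re]

theorem ContDiff.normSq {f : E → ℂ} {n : WithTop ℕ∞} (hf : ContDiff ℝ n f) :
    ContDiff ℝ n (fun q => Complex.normSq (f q)) := by
  simp only [Complex.normSq_apply]
  have hre : ContDiff ℝ n (fun q => (f q).re) := Complex.reCLM.contDiff.comp hf
  have him : ContDiff ℝ n (fun q => (f q).im) := Complex.imCLM.contDiff.comp hf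
  exact (hre.mul hre).add (him.mul him)

theorem fderiv_fderiv_fderiv_comm {f : E → F} (hf : ContDiff ℝ 3 f) (v w p : E) :
    fderiv ℝ (fun q => fderiv ℝ (fun s => fderiv ℝ f s w) q v) p v
      = fderiv ℝ (fun q => fderiv ℝ (fun s => fderiv ℝ f s v) q v) p w := by
  have h2 : ContDiff ℝ 2 f := hf.of_le (by norm_num)
  rw [funext fun q => h2.fderiv_fderiv_comm w v q,
    (hf.fderiv_apply_const (m := 2) (by norm_num) v).fderiv_fderiv_comm w v p]

/-- Momentum balance for a gauged nonlinear wave equation: the divergence of the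
energy-momentum tensor in the direction `x` equals the Lorentz force of the curvature. -/
theorem covariant_momentum_balance {ε κ γ : ℝ} (hγ : 1 < γ) (t x y : E) {ψ : E → ℂ}
    {a b c : E → ℝ} (hψ : ContDiff ℝ 3 ψ) (ha : ContDiff ℝ 2 a) (hb : ContDiff ℝ 2 b)
    (hc : ContDiff ℝ 2 c)
    (hE : ∀ p, Complex.I * (ε : ℂ) * covDeriv t a ψ p
        - ((κ / 2 : ℝ) : ℂ) * covDeriv t a (covDeriv t a ψ) p
        + ((ε ^ 2 / 2 : ℝ) : ℂ)
          * (covDeriv x b (covDeriv x b ψ) p + covDeriv y c (covDeriv y c ψ) p)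
        - ((γ / (γ - 1) * Complex.normSq (ψ p) ^ (γ - 1) : ℝ) : ℂ) * ψ p = 0) (p : E) :
    ε * fderiv ℝ (fun q => (conj (ψ q) * covDeriv x b ψ q).im) p t
      - κ * fderiv ℝ (fun q => (conj (covDeriv t a ψ q) * covDeriv x b ψ q).re) p t
      + ε ^ 2 * (fderiv ℝ (fun q => (conj (covDeriv x b ψ q) * covDeriv x b ψ q).re) p x
        + fderiv ℝ (fun q => (conj (covDeriv x b ψ q) * covDeriv y c ψ q).re) p y)
      - ε ^ 2 / 4 * fderiv ℝ (fun q =>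
          fderiv ℝ (fun r => fderiv ℝ (fun s => Complex.normSq (ψ s)) r x) q x
          + fderiv ℝ (fun r => fderiv ℝ (fun s => Complex.normSq (ψ s)) r y) q y) p x
      + fderiv ℝ (fun q => Complex.normSq (ψ q) ^ γ) p x
      + κ / 4 * fderiv ℝ (fun q =>
          fderiv ℝ (fun r => fderiv ℝ (fun s => Complex.normSq (ψ s)) r x) q t) p t
    = (fderiv ℝ b p t - fderiv ℝ a p x)
        * (κ * (conj (ψ p) * covDeriv t a ψ p).im - ε * Complex.normSq (ψ p))
      - ε ^ 2 * (fderiv ℝ b p y - fderiv ℝ c p x) * (conj (ψ p) * covDeriv y c ψ p).im := by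
  have hψ2 : ContDiff ℝ 2 ψ := hψ.of_le (by norm_num)
  have hd : Differentiable ℝ ψ := hψ.differentiable (by norm_num)
  have had : Differentiable ℝ a := ha.differentiable (by norm_num)
  have hbd : Differentiable ℝ b := hb.differentiable (by norm_num)
  have hcd : Differentiable ℝ c := hc.differentiable (by norm_num)
  have hT : Differentiable ℝ (covDeriv t a ψ) :=
    (hψ.covDeriv ha (by norm_num) t).differentiable (by norm_num)
  have hX : Differentiable ℝ (covDeriv x b ψ) :=
    (hψ.covDeriv hb (by norm_num) x).differentiable (by norm_num)
  have hY : Differentiable ℝ (covDeriv y c ψ) :=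
    (hψ.covDeriv hc (by norm_num) y).differentiable (by norm_num)
  have hρ : ContDiff ℝ 3 (fun q => Complex.normSq (ψ q)) := hψ.normSq
  have hρd : DifferentiableAt ℝ (fun q => Complex.normSq (ψ q)) p :=
    hρ.differentiable (by norm_num) p
  have hρ2 : ∀ v, DifferentiableAt ℝ
      (fun q => fderiv ℝ (fun r => fderiv ℝ (fun s => Complex.normSq (ψ s)) r v) q v) p :=
    fun v => ((hρ.fderiv_apply_const (m := 2) (by norm_num) v).fderiv_apply_const
      (m := 1) (by norm_num) v).differentiable (by norm_num) p
  have hpow : HasFDerivAt (fun q => Complex.normSq (ψ q) ^ γ) _ p :=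
    hρd.hasFDerivAt.rpow_const (p := γ) (Or.inr hγ.le)
  have hJ : DifferentiableAt ℝ (fun q => (conj (ψ q) * covDeriv t a ψ q).im) p :=
    Complex.imCLM.differentiable.comp (hd.conj_mul hT) p
  have hsq : ∀ {f : E → ℂ}, Differentiable ℝ f →
      DifferentiableAt ℝ (fun q => (conj (f q) * f q).re) p :=
    fun hf => Complex.reCLM.differentiable.comp (hf.conj_mul hf) p
  -- the real part of the equation multiplied by `conj ψ`
  have hS : ∀ q, γ / (γ - 1) * Complex.normSq (ψ q) ^ γ
      = -ε * (conj (ψ q) * covDeriv t a ψ q).im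
        - κ / 4 * fderiv ℝ (fun r => fderiv ℝ (fun s => Complex.normSq (ψ s)) r t) q t
        + κ / 2 * (conj (covDeriv t a ψ q) * covDeriv t a ψ q).re
        + ε ^ 2 / 4 * (fderiv ℝ (fun r => fderiv ℝ (fun s => Complex.normSq (ψ s)) r x) q x
          + fderiv ℝ (fun r => fderiv ℝ (fun s => Complex.normSq (ψ s)) r y) q y)
        - ε ^ 2 / 2 * ((conj (covDeriv x b ψ q) * covDeriv x b ψ q).re
          + (conj (covDeriv y c ψ q) * covDeriv y c ψ q).re) := by
    intro q
    have hp : Complex.normSq (ψ q) ^ γ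
        = Complex.normSq (ψ q) ^ (γ - 1) * Complex.normSq (ψ q) := by
      rw [← Real.rpow_add_one' (Complex.normSq_nonneg _) (by linarith), sub_add_cancel]
    have h := congrArg (fun z => (conj (ψ q) * z).re) (hE q)
    rw [fderiv_fderiv_normSq_apply hψ2 (ha.of_le (by norm_num)) t,
      fderiv_fderiv_normSq_apply hψ2 (hb.of_le (by norm_num)) x,
      fderiv_fderiv_normSq_apply hψ2 (hc.of_le (by norm_num)) y, hp]
    simp only [Complex.normSq_apply, Complex.add_re, Complex.sub_re, Complex.mul_re,
      Complex.add_im, Complex.sub_im, Complex.mul_im, Complex.conj_re, Complex.conj_im,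
      Complex.I_re, Complex.I_im, Complex.ofReal_re, Complex.ofReal_im, Complex.zero_re,
      Complex.zero_im] at h ⊢
    linear_combination -h
  have hΔ := (hρ2 x).fun_add (hρ2 y)
  have hR := ((((hJ.hasFDerivAt.const_mul (-ε)).fun_sub
    ((hρ2 t).hasFDerivAt.const_mul (κ / 4))).fun_add
    ((hsq hT).hasFDerivAt.const_mul (κ / 2))).fun_add
    (hΔ.hasFDerivAt.const_mul (ε ^ 2 / 4))).fun_sub
    (((hsq hX).hasFDerivAt.fun_add (hsq hY).hasFDerivAt).const_mul (ε ^ 2 / 2))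
  rw [← funext hS] at hR
  have hdS := congrArg (fun L => L x)
    ((hpow.differentiableAt.hasFDerivAt.const_mul (γ / (γ - 1))).unique hR)
  simp only [add_apply, sub_apply, smul_apply, smul_eq_mul] at hdS
  have hγ1 : γ - 1 ≠ 0 := by linarith
  -- the real part of the equation multiplied by `conj D_x ψ`
  have hM := congrArg (fun z => (conj (covDeriv x b ψ p) * z).re) (hE p)
  have hP : fderiv ℝ (fun q => Complex.normSq (ψ q) ^ γ) p x
      = γ * Complex.normSq (ψ p) ^ (γ - 1) * (2 * (conj (ψ p) * covDeriv x b ψ p).re) := by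
    rw [hpow.fderiv, ← fderiv_normSq_apply hd x b p]
    simp
  have hP' : fderiv ℝ (fun q => Complex.normSq (ψ q) ^ γ) p x
      = γ / (γ - 1) * fderiv ℝ (fun q => Complex.normSq (ψ q) ^ γ) p x
        - γ / (γ - 1) * Complex.normSq (ψ p) ^ (γ - 1)
          * (2 * (conj (ψ p) * covDeriv x b ψ p).re) := by
    rw [hP]
    field_simp
  rw [hP', hdS, fderiv_fderiv_fderiv_comm hρ t x p]
  rw [fderiv_im_conj_mul_apply hd hX t a, fderiv_re_conj_mul_apply hT hX t a,
    fderiv_re_conj_mul_apply hX hX x b, fderiv_re_conj_mul_apply hX hY y c,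
    fderiv_im_conj_mul_apply hd hT x b, fderiv_re_conj_mul_apply hT hT x b,
    fderiv_re_conj_mul_apply hY hY x b, covDeriv_comm hψ2 had hbd t x p,
    covDeriv_comm hψ2 hcd hbd y x p]
  simp only [Complex.normSq_apply, Complex.add_re, Complex.sub_re, Complex.mul_re,
    Complex.add_im, Complex.sub_im, Complex.mul_im, Complex.conj_re, Complex.conj_im,
    Complex.I_re, Complex.I_im, Complex.ofReal_re, Complex.ofReal_im, Complex.zero_re,
    Complex.zero_im, map_sub] at hM ⊢
  linear_combination 2 * hM

/-- Symmetrised products in complex notation are twice the real part. -/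
theorem fderiv_mul_conj_add_conj_mul_apply {f g : E → ℂ} (hf : Differentiable ℝ f)
    (hg : Differentiable ℝ g) (v p : E) :
    fderiv ℝ (fun q => f q * conj (g q) + conj (f q) * g q) p v
      = ((2 * fderiv ℝ (fun q => (conj (f q) * g q).re) p v : ℝ) : ℂ) := by
  have h : (fun q => f q * conj (g q) + conj (f q) * g q)
      = fun q => ((2 * (conj (f q) * g q).re : ℝ) : ℂ) := by
    funext q
    apply Complex.ext <;> simp <;> ring
  have hre : DifferentiableAt ℝ (fun q => (conj (f q) * g q).re) p :=
    Complex.reCLM.differentiable.comp (hf.conj_mul hg) p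
  rw [h, fderiv_ofReal_apply (hre.const_mul 2), fderiv_const_mul hre]
  simp

end CovariantCalculus

theorem ptd_eq {F : Type*} [NormedAddCommGroup F] [NormedSpace ℝ F] (f : Spt → F) :
    ptd f = fun p => fderiv ℝ f p (1, 0, 0) := rfl

theorem px1_eq {F : Type*} [NormedAddCommGroup F] [NormedSpace ℝ F] (f : Spt → F) :
    px1 f = fun p => fderiv ℝ f p (0, 1, 0) := rfl

theorem px2_eq {F : Type*} [NormedAddCommGroup F] [NormedSpace ℝ F] (f : Spt → F) :
    px2 f = fun p => fderiv ℝ f p (0, 0, 1) := rfl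

theorem Dt_eq_covDeriv (ε : ℝ) (A₀ : Spt → ℝ) (ψ : Spt → ℂ) :
    Dt ε A₀ ψ = covDeriv (1, 0, 0) (fun q => ε⁻¹ * A₀ q) ψ := by
  funext p
  simp only [Dt, ptd, covDeriv]
  push_cast
  ring

theorem D1_eq_covDeriv (ε δ : ℝ) (A₁ : Spt → ℝ) (ψ : Spt → ℂ) :
    D1 ε δ A₁ ψ = covDeriv (0, 1, 0) (fun q => ε ^ (δ - 1) * A₁ q) ψ := by
  funext p
  simp only [D1, px1, covDeriv]
  push_cast
  ring

theorem D2_eq_covDeriv (ε δ : ℝ) (A₂ : Spt → ℝ) (ψ : Spt → ℂ) :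
    D2 ε δ A₂ ψ = covDeriv (0, 0, 1) (fun q => ε ^ (δ - 1) * A₂ q) ψ := by
  funext p
  simp only [D2, px2, covDeriv]
  push_cast
  ring

/-- Momentum conservation law for the scaled Chern–Simons–Higgs system, `j = 1, 2`:
`ε ∂_t Im(conj ψ · D_jψ) − ε^{2+2δ} ∂_t Re(conj(D_tψ) · D_jψ)
  + (ε²/2) Σ_k ∂_k(D_jψ conj(D_kψ) + conj(D_jψ) D_kψ)
  − (ε²/4) ∂_j(Δ|ψ|²) + ∂_j(|ψ|^{2γ}) + (ε^{2+2δ}/4) ∂_t∂_t∂_j|ψ|² = 0`. -/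
theorem csh_momentum_conservation (ε δ γ : ℝ) (hε : 0 < ε) (hδ : 0 < δ) (hγ : 1 < γ)
    (ψ : Spt → ℂ) (A₀ A₁ A₂ : Spt → ℝ)
    (hψ : ContDiff ℝ 3 ψ) (hA₀ : ContDiff ℝ 2 A₀)
    (hA₁ : ContDiff ℝ 2 A₁) (hA₂ : ContDiff ℝ 2 A₂)
    (hE1 : ∀ p : Spt,
      Complex.I * (ε : ℂ) * Dt ε A₀ ψ p
        - ((ε ^ (2 + 2 * δ) / 2 : ℝ) : ℂ) * Dt ε A₀ (Dt ε A₀ ψ) p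
        + ((ε ^ 2 / 2 : ℝ) : ℂ) *
            (D1 ε δ A₁ (D1 ε δ A₁ ψ) p + D2 ε δ A₂ (D2 ε δ A₂ ψ) p)
        - ((γ / (γ - 1) * Complex.normSq (ψ p) ^ (γ - 1) : ℝ) : ℂ) * ψ p = 0)
    (hE2a : ∀ p : Spt,
      ε ^ δ * ptd A₁ p - px1 A₀ p
        = -(ε * ((starRingEnd ℂ) (ψ p) * D2 ε δ A₂ ψ p).im))
    (hE2b : ∀ p : Spt,
      ε ^ δ * ptd A₂ p - px2 A₀ p
        = ε * ((starRingEnd ℂ) (ψ p) * D1 ε δ A₁ ψ p).im)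
    (hE3 : ∀ p : Spt,
      ε ^ δ * (px1 A₂ p - px2 A₁ p)
        = -Complex.normSq (ψ p)
          + ε ^ (1 + 2 * δ) * ((starRingEnd ℂ) (ψ p) * Dt ε A₀ ψ p).im) :
    ∀ p : Spt,
      (((ε * ptd (fun q => ((starRingEnd ℂ) (ψ q) * D1 ε δ A₁ ψ q).im) p : ℝ) : ℂ)
          - ((ε ^ (2 + 2 * δ) *
              ptd (fun q => ((starRingEnd ℂ) (Dt ε A₀ ψ q) * D1 ε δ A₁ ψ q).re) p : ℝ) : ℂ)
          + ((ε ^ 2 / 2 : ℝ) : ℂ) *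
              (px1 (fun q => D1 ε δ A₁ ψ q * (starRingEnd ℂ) (D1 ε δ A₁ ψ q)
                    + (starRingEnd ℂ) (D1 ε δ A₁ ψ q) * D1 ε δ A₁ ψ q) p
                + px2 (fun q => D1 ε δ A₁ ψ q * (starRingEnd ℂ) (D2 ε δ A₂ ψ q)
                    + (starRingEnd ℂ) (D1 ε δ A₁ ψ q) * D2 ε δ A₂ ψ q) p)
          - ((ε ^ 2 / 4 *
              px1 (fun q => px1 (px1 (fun s => Complex.normSq (ψ s))) q
                    + px2 (px2 (fun s => Complex.normSq (ψ s))) q) p : ℝ) : ℂ)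
          + ((px1 (fun q => Complex.normSq (ψ q) ^ γ) p : ℝ) : ℂ)
          + ((ε ^ (2 + 2 * δ) / 4 *
              ptd (ptd (px1 (fun s => Complex.normSq (ψ s)))) p : ℝ) : ℂ) = 0)
      ∧
      (((ε * ptd (fun q => ((starRingEnd ℂ) (ψ q) * D2 ε δ A₂ ψ q).im) p : ℝ) : ℂ)
          - ((ε ^ (2 + 2 * δ) *
              ptd (fun q => ((starRingEnd ℂ) (Dt ε A₀ ψ q) * D2 ε δ A₂ ψ q).re) p : ℝ) : ℂ)
          + ((ε ^ 2 / 2 : ℝ) : ℂ) *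
              (px1 (fun q => D2 ε δ A₂ ψ q * (starRingEnd ℂ) (D1 ε δ A₁ ψ q)
                    + (starRingEnd ℂ) (D2 ε δ A₂ ψ q) * D1 ε δ A₁ ψ q) p
                + px2 (fun q => D2 ε δ A₂ ψ q * (starRingEnd ℂ) (D2 ε δ A₂ ψ q)
                    + (starRingEnd ℂ) (D2 ε δ A₂ ψ q) * D2 ε δ A₂ ψ q) p)
          - ((ε ^ 2 / 4 *
              px2 (fun q => px1 (px1 (fun s => Complex.normSq (ψ s))) q
                    + px2 (px2 (fun s => Complex.normSq (ψ s))) q) p : ℝ) : ℂ)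
          + ((px2 (fun q => Complex.normSq (ψ q) ^ γ) p : ℝ) : ℂ)
          + ((ε ^ (2 + 2 * δ) / 4 *
              ptd (ptd (px2 (fun s => Complex.normSq (ψ s)))) p : ℝ) : ℂ) = 0) := by
  intro p
  have ha : ContDiff ℝ 2 (fun q => ε⁻¹ * A₀ q) := contDiff_const.mul hA₀
  have hb : ContDiff ℝ 2 (fun q => ε ^ (δ - 1) * A₁ q) := contDiff_const.mul hA₁
  have hc : ContDiff ℝ 2 (fun q => ε ^ (δ - 1) * A₂ q) := contDiff_const.mul hA₂
  have hX : Differentiable ℝ (covDeriv (0, 1, 0) (fun q => ε ^ (δ - 1) * A₁ q) ψ) :=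
    (hψ.covDeriv hb (by norm_num) _).differentiable (by norm_num)
  have hY : Differentiable ℝ (covDeriv (0, 0, 1) (fun q => ε ^ (δ - 1) * A₂ q) ψ) :=
    (hψ.covDeriv hc (by norm_num) _).differentiable (by norm_num)
  have hscale : ∀ (r : ℝ) {A : Spt → ℝ}, ContDiff ℝ 2 A → ∀ v : Spt,
      fderiv ℝ (fun q => r * A q) p v = r * fderiv ℝ A p v := by
    intro r A hA v
    rw [fderiv_const_mul (hA.differentiable (by norm_num) p)]
    simp
  simp only [Dt_eq_covDeriv, D1_eq_covDeriv, D2_eq_covDeriv] at hE1 hE2a hE2b hE3 ⊢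
  have h1 := covariant_momentum_balance hγ (1, 0, 0) (0, 1, 0) (0, 0, 1) hψ ha hb hc hE1 p
  have h2 := covariant_momentum_balance hγ (1, 0, 0) (0, 0, 1) (0, 1, 0) hψ ha hc hb
    (fun q => by rw [add_comm (covDeriv (0, 0, 1) _ _ q)]; exact hE1 q) p
  have e2a := hE2a p
  have e2b := hE2b p
  have e3 := hE3 p
  have hδ1 : ε ^ (δ - 1) = ε⁻¹ * ε ^ δ := by
    rw [Real.rpow_sub_one hε.ne']; ring
  have hκ : ε ^ (2 + 2 * δ) = ε * ε ^ (1 + 2 * δ) := by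
    rw [← Real.rpow_one_add' hε.le (by linarith)]; ring_nf
  simp only [hscale _ hA₀, hscale _ hA₁, hscale _ hA₂] at h1 h2
  simp only [ptd_eq, px1_eq, px2_eq] at e2a e2b e3 ⊢
  rw [fderiv_mul_conj_add_conj_mul_apply hX hX, fderiv_mul_conj_add_conj_mul_apply hX hY,
    fderiv_mul_conj_add_conj_mul_apply hY hX, fderiv_mul_conj_add_conj_mul_apply hY hY]
  generalize ((starRingEnd ℂ) (ψ p) * covDeriv (1, 0, 0) _ ψ p).im = J₀ at h1 h2 e3
  generalize ((starRingEnd ℂ) (ψ p) * covDeriv (0, 1, 0) _ ψ p).im = J₁ at h2 e2b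
  generalize ((starRingEnd ℂ) (ψ p) * covDeriv (0, 0, 1) _ ψ p).im = J₂ at h1 e2a
  rw [hδ1, hκ] at h1 h2
  rw [hδ1, hκ]
  simp only [add_comm (fderiv ℝ _ _ ((0, 0, 1) : Spt)) (fderiv ℝ _ _ ((0, 1, 0) : Spt))] at h2
  constructor
  · norm_cast
    linear_combination h1 + (ε * ε ^ (1 + 2 * δ) * J₀ - ε * Complex.normSq (ψ p)) * ε⁻¹ * e2a
      + ε ^ 2 * ε⁻¹ * J₂ * e3
  · norm_cast
    linear_combination h2 + (ε * ε ^ (1 + 2 * δ) * J₀ - ε * Complex.normSq (ψ p)) * ε⁻¹ * e2b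
      - ε ^ 2 * ε⁻¹ * J₁ * e3

end
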